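/- For a bounded sequence (λ_k)_{k∈ℤ} of complex numbers, the convolution operator Conv_λ on L²(𝕋), acting diagonally in the Fourier basis by (Conv_λ f)_k = λ_k f_k, has operator norm ‖Conv_λ‖ = sup_{k∈ℤ} |λ_k| and μ-norm ‖Conv_λ‖_μ² = ρ(λ), where ρ(λ) = limsup_{#I→∞} (1/#I) Σ_{k∈I} |λ_k|² over integer intervals I ⊂ ℤ. -/

import Mathlib

open MeasureTheory Real Filter
open scoped ENNReal

namespace MuNorm

variable {𝒳 : Type*} [MeasurableSpace 𝒳]

/-- A finite measurable partition of `𝒳` (up to measure zero). -/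
structure Partition (μ : Measure 𝒳) where
  J : ℕ
  Y : Fin J → Set 𝒳
  meas : ∀ j, MeasurableSet (Y j)
  cover : μ (Set.univ \ ⋃ j, Y j) = 0
  disj : ∀ j k, j ≠ k → μ (Y j ∩ Y k) = 0

/-- `ℳ_χ(W) = ∑_j μ(Y_j) ‖W π_{Y_j}‖²`. -/
noncomputable def M (μ : Measure 𝒳)
    (proj : Set 𝒳 → (Lp ℂ 2 μ →L[ℂ] Lp ℂ 2 μ))
    (W : Lp ℂ 2 μ →L[ℂ] Lp ℂ 2 μ) (χ : Partition μ) : ℝ :=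
  ∑ j, (μ (χ.Y j)).toReal * ‖W.comp (proj (χ.Y j))‖ ^ 2

/-- `‖W‖_μ = inf_χ sqrt(ℳ_χ(W))`. -/
noncomputable def munorm (μ : Measure 𝒳)
    (proj : Set 𝒳 → (Lp ℂ 2 μ →L[ℂ] Lp ℂ 2 μ))
    (W : Lp ℂ 2 μ →L[ℂ] Lp ℂ 2 μ) : ℝ :=
  ⨅ χ : Partition μ, Real.sqrt (M μ proj W χ)

/-- `proj Y` is the operator of multiplication by the indicator of `Y`. -/
def IsIndicatorProj (μ : Measure 𝒳)
    (proj : Set 𝒳 → (Lp ℂ 2 μ →L[ℂ] Lp ℂ 2 μ)) : Prop :=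
  ∀ Y : Set 𝒳, MeasurableSet Y → ∀ f : Lp ℂ 2 μ,
    (proj Y f : 𝒳 → ℂ) =ᵐ[μ] Y.indicator f

local instance : Fact (0 < 2 * π) := ⟨by positivity⟩

/-- `ρ(λ) = limsup_{#I → ∞} (1/#I) ∑_{k ∈ I} |λ_k|²`, the limsup of averages over
integer intervals `I = [a, a + N)` as their length `N` tends to infinity. -/
noncomputable def rho (lam : ℤ → ℂ) : ℝ :=
  Filter.limsup
    (fun p : ℤ × ℕ =>
      (1 / (p.2 : ℝ)) * ∑ k ∈ Finset.Ico p.1 (p.1 + (p.2 : ℤ)), ‖lam k‖ ^ 2)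
    (Filter.comap Prod.snd Filter.atTop)

section Helpers

open AddCircle

variable {T : ℝ} [hT : Fact (0 < T)]

lemma parseval (f : Lp ℂ 2 (@haarAddCircle T hT)) :
    HasSum (fun k : ℤ => ‖fourierBasis.repr f k‖ ^ 2) (‖f‖ ^ 2) := by
  have h := lp.hasSum_norm (p := 2) (by norm_num) (fourierBasis.repr f)
  simpa using h

lemma fourier_norm_apply (m : ℤ) (x : AddCircle T) : ‖fourier m x‖ = 1 := by
  rw [fourier_apply]; exact Circle.norm_coe _

lemma exists_shift (m : ℤ) (f : Lp ℂ 2 (@haarAddCircle T hT)) :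
    ∃ g : Lp ℂ 2 (@haarAddCircle T hT),
      (g : AddCircle T → ℂ) =ᵐ[haarAddCircle] (fun x => fourier m x * f x) ∧
      ∀ k, fourierBasis.repr g k = fourierBasis.repr f (k - m) := by
  have hm : MemLp (fun x => fourier m x * f x) 2 (@haarAddCircle T hT) := by
    refine MemLp.of_le_mul (c := 1) (Lp.memLp f) ?_ ?_
    · exact ((fourier m).continuous.aestronglyMeasurable).mul (Lp.aestronglyMeasurable f)
    · refine Eventually.of_forall fun x => ?_
      rw [norm_mul, fourier_norm_apply]
  refine ⟨hm.toLp, hm.coeFn_toLp, fun k => ?_⟩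
  rw [fourierBasis_repr, fourierBasis_repr, fourierCoeff_congr_ae hm.coeFn_toLp]
  unfold fourierCoeff
  congr 1
  ext x
  have : -(k - m) = -k + m := by ring
  rw [this, fourier_add, smul_eq_mul, smul_eq_mul, mul_assoc]

/-- The sum of `‖λ‖²` over the window `[a, a + N)`. -/
noncomputable def win (lam : ℤ → ℂ) (a : ℤ) (N : ℕ) : ℝ :=
  ∑ j ∈ Finset.range N, ‖lam (a + j)‖ ^ 2

lemma win_eq (lam : ℤ → ℂ) (a : ℤ) (N : ℕ) :
    ∑ k ∈ Finset.Ico a (a + (N : ℤ)), ‖lam k‖ ^ 2 = win lam a N := by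
  unfold win
  symm
  refine Finset.sum_bij (fun j _ => a + (j : ℤ)) ?_ ?_ ?_ ?_
  · intro j hj
    simp only [Finset.mem_range, Finset.mem_Ico] at *
    omega
  · intro i _ j _ h
    omega
  · intro b hb
    simp only [Finset.mem_Ico] at hb
    exact ⟨(b - a).toNat, by simp only [Finset.mem_range]; omega, by omega⟩
  · intros; rfl

lemma win_nonneg (lam : ℤ → ℂ) (a : ℤ) (N : ℕ) : 0 ≤ win lam a N :=
  Finset.sum_nonneg fun _ _ => by positivity

lemma win_le (lam : ℤ → ℂ) (C : ℝ) (hbd : ∀ k, ‖lam k‖ ≤ C) (a : ℤ) (N : ℕ) :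
    win lam a N ≤ N * C ^ 2 := by
  unfold win
  calc _ ≤ ∑ j ∈ Finset.range N, C ^ 2 := Finset.sum_le_sum fun j _ => by
        have := hbd (a + j)
        gcongr
    _ = _ := by simp

lemma win_succ (lam : ℤ → ℂ) (C : ℝ) (hbd : ∀ k, ‖lam k‖ ≤ C) (a : ℤ) (N : ℕ) :
    |win lam (a + 1) N - win lam a N| ≤ C ^ 2 := by
  have h1 : win lam a (N + 1) = win lam (a + 1) N + ‖lam a‖ ^ 2 := by
    unfold win
    rw [Finset.sum_range_succ']
    congr 1
    · refine Finset.sum_congr rfl fun j _ => ?_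
      congr 3; push_cast; ring
    · simp
  have h2 : win lam a (N + 1) = win lam a N + ‖lam (a + N)‖ ^ 2 := by
    unfold win
    rw [Finset.sum_range_succ]
  have e1 : ‖lam a‖ ^ 2 ≤ C ^ 2 := by have := hbd a; gcongr
  have e2 : ‖lam (a + N)‖ ^ 2 ≤ C ^ 2 := by have := hbd (a + N); gcongr
  have e3 : 0 ≤ ‖lam a‖ ^ 2 := by positivity
  have e4 : 0 ≤ ‖lam (a + N)‖ ^ 2 := by positivity
  rw [abs_le]; constructor <;> linarith

lemma win_shift (lam : ℤ → ℂ) (C : ℝ) (hbd : ∀ k, ‖lam k‖ ≤ C) (a m : ℤ) (N : ℕ) :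
    |win lam (m + a) N - win lam a N| ≤ |(m : ℝ)| * C ^ 2 := by
  have key : ∀ (n : ℕ) (a : ℤ), |win lam (a + n) N - win lam a N| ≤ n * C ^ 2 := by
    intro n
    induction n with
    | zero => intro a; simp
    | succ n ih =>
      intro a
      have h1 := ih a
      have h2 := win_succ lam C hbd (a + n) N
      have h3 : a + (n + 1 : ℕ) = a + n + 1 := by push_cast; ring
      rw [h3]
      have := abs_sub_le (win lam (a + n + 1) N) (win lam (a + n) N) (win lam a N)
      push_cast
      linarith
  rcases le_total 0 m with h | h
  · lift m to ℕ using h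
    have := key m a
    rw [add_comm] at this
    simpa using this
  · obtain ⟨n, rfl⟩ : ∃ n : ℕ, m = -n := ⟨m.natAbs, by omega⟩
    have := key n (-n + a)
    rw [show -(n : ℤ) + a + n = a by ring, abs_sub_comm] at this
    simpa using this

section Op

variable (lam : ℤ → ℂ) (C : ℝ) (hbd : ∀ k, ‖lam k‖ ≤ C)
  (W : Lp ℂ 2 (@haarAddCircle T hT) →L[ℂ] Lp ℂ 2 (@haarAddCircle T hT))
  (hW : ∀ f, ∀ k : ℤ, fourierBasis.repr (W f) k = lam k * fourierBasis.repr f k)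

include hW

lemma parsevalW (f : Lp ℂ 2 (@haarAddCircle T hT)) :
    HasSum (fun k : ℤ => ‖lam k‖ ^ 2 * ‖fourierBasis.repr f k‖ ^ 2) (‖W f‖ ^ 2) := by
  have := parseval (W f)
  simpa [hW, mul_pow] using this

lemma normW_apply_le (D : ℝ) (hD : ∀ k, ‖lam k‖ ≤ D) (f : Lp ℂ 2 (@haarAddCircle T hT)) :
    ‖W f‖ ≤ D * ‖f‖ := by
  have hD0 : 0 ≤ D := (norm_nonneg _).trans (hD 0)
  have h := hasSum_le (fun k => ?_) (parsevalW lam W hW f) ((parseval f).mul_left (D ^ 2))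
  · rw [← mul_pow] at h
    exact (sq_le_sq₀ (norm_nonneg _) (by positivity)).1 h
  · have := hD k
    simp only
    gcongr

include hbd in
lemma normW_eq : ‖W‖ = ⨆ k : ℤ, ‖lam k‖ := by
  have hb : BddAbove (Set.range fun k : ℤ => ‖lam k‖) := ⟨C, by rintro _ ⟨k, rfl⟩; exact hbd k⟩
  apply le_antisymm
  · refine ContinuousLinearMap.opNorm_le_bound _ (Real.iSup_nonneg fun k => norm_nonneg _) fun f => ?_
    exact normW_apply_le lam W hW _ (fun k => le_ciSup hb k) f
  · refine ciSup_le fun k => ?_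
    set e := (fourierBasis (T := T)) k with he
    have hn : ‖e‖ = 1 := (fourierBasis (T := T)).orthonormal.1 k
    have h1 : ‖fourierBasis.repr (W e) k‖ ≤ ‖W e‖ := by
      have := lp.norm_apply_le_norm (p := 2) (by norm_num) (fourierBasis.repr (W e)) k
      simpa using this
    have h2 : fourierBasis.repr e k = 1 := by
      rw [he, HilbertBasis.repr_self]; simp
    rw [hW, h2, mul_one] at h1
    have := W.le_opNorm e
    rw [hn, mul_one] at this
    linarith

lemma shift_sum (a : ℤ) (N : ℕ) (f : Lp ℂ 2 (@haarAddCircle T hT))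
    (g : ℕ → Lp ℂ 2 (@haarAddCircle T hT))
    (hg : ∀ j k, fourierBasis.repr (g j) k = fourierBasis.repr f (k - (a + j))) :
    HasSum (fun m : ℤ => win lam (m + a) N * ‖fourierBasis.repr f m‖ ^ 2)
      (∑ j ∈ Finset.range N, ‖W (g j)‖ ^ 2) := by
  have h : ∀ j ∈ Finset.range N,
      HasSum (fun m : ℤ => ‖lam (m + a + j)‖ ^ 2 * ‖fourierBasis.repr f m‖ ^ 2)
        (‖W (g j)‖ ^ 2) := by
    intro j _
    have h1 := (Equiv.addRight (a + (j : ℤ))).hasSum_iff.2 (parsevalW lam W hW (g j))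
    convert h1 using 2 with m
    simp [hg, add_assoc]
  have h2 := hasSum_sum h
  convert h2 using 2 with m
  rw [win, Finset.sum_mul]

lemma parseval_shift (j : ℤ) (f g : Lp ℂ 2 (@haarAddCircle T hT))
    (hg : ∀ k, fourierBasis.repr g k = fourierBasis.repr f (k - j)) : ‖g‖ = ‖f‖ := by
  have h1 := (Equiv.addRight j).hasSum_iff.2 (parseval g)
  have h2 : (fun k : ℤ => ‖fourierBasis.repr g k‖ ^ 2) ∘ (Equiv.addRight j) =
      fun k => ‖fourierBasis.repr f k‖ ^ 2 := by
    ext k; simp [hg]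
  rw [h2] at h1
  have := h1.unique (parseval f)
  exact (sq_eq_sq₀ (norm_nonneg _) (norm_nonneg _)).1 this

include hbd in
/-- Upper bound for functions on which the characters are nearly constant. -/
lemma upper (L : ℕ) (hL : 0 < L) (B η : ℝ) (hη : 0 ≤ η) (hη1 : η ≤ 1)
    (hB : ∀ a, win lam a L ≤ L * B)
    (f : Lp ℂ 2 (@haarAddCircle T hT)) (ζ : ℕ → ℂ) (hζ : ∀ j, ‖ζ j‖ = 1)
    (hf : ∀ j < L, ∀ᵐ x ∂(@haarAddCircle T hT),
      ‖(ζ j - fourier (j : ℤ) x) * f x‖ ≤ η * ‖f x‖) :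
    ‖W f‖ ^ 2 ≤ (B + 3 * C ^ 2 * η) * ‖f‖ ^ 2 := by
  have hC0 : 0 ≤ C := (norm_nonneg _).trans (hbd 0)
  choose g hg1 hg2 using fun j : ℕ => exists_shift (j : ℤ) f
  have hs := shift_sum lam W hW 0 L f g (by simpa using hg2)
  have h1 := hasSum_le (fun m => by
    have := hB (m + 0)
    gcongr) hs ((parseval f).mul_left (L * B))
  have h2 : ∀ j ∈ Finset.range L, ‖W f‖ ^ 2 ≤ ‖W (g j)‖ ^ 2 + 3 * C ^ 2 * η * ‖f‖ ^ 2 := by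
    intro j hj
    have hd : ‖ζ j • f - g j‖ ≤ η * ‖f‖ := by
      apply Lp.norm_le_mul_norm_of_ae_le_mul
      filter_upwards [hf j (Finset.mem_range.1 hj), hg1 j, Lp.coeFn_sub (ζ j • f) (g j),
        Lp.coeFn_smul (ζ j) f] with x h1 h2 h3 h4
      rw [h3, Pi.sub_apply, h4, h2, Pi.smul_apply, smul_eq_mul, ← sub_mul]
      exact h1
    have e1 : ‖W f‖ ≤ ‖W (g j)‖ + C * (η * ‖f‖) := by
      have : ‖W f‖ = ‖W (g j) + W (ζ j • f - g j)‖ := by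
        rw [← map_add, add_sub_cancel, map_smul, norm_smul, hζ, one_mul]
      rw [this]
      refine (norm_add_le _ _).trans ?_
      gcongr
      refine (normW_apply_le lam W hW C hbd _).trans ?_
      gcongr
    have e2 : ‖W (g j)‖ ≤ C * ‖f‖ := by
      rw [← parseval_shift lam W hW j f (g j) (hg2 j)]
      exact normW_apply_le lam W hW C hbd _
    have e3 : ‖W f‖ ^ 2 ≤ (‖W (g j)‖ + C * (η * ‖f‖)) ^ 2 := by gcongr
    have e4 : ‖W (g j)‖ * (C * (η * ‖f‖)) ≤ C * ‖f‖ * (C * (η * ‖f‖)) := by gcongr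
    have e5 : (C * ‖f‖) ^ 2 * η * η ≤ (C * ‖f‖) ^ 2 * η * 1 := by gcongr
    nlinarith
  have h3 := Finset.sum_le_sum h2
  rw [Finset.sum_add_distrib] at h3
  simp only [Finset.sum_const, Finset.card_range, nsmul_eq_mul] at h3
  have hLp : (0 : ℝ) < L := by exact_mod_cast hL
  refine le_of_mul_le_mul_left ?_ hLp
  nlinarith

include hbd in
/-- Lower bound. -/
lemma lower (A : ℝ) (f : Lp ℂ 2 (@haarAddCircle T hT)) (hf : f ≠ 0)
    (hA : ∀ (j : ℤ) (g : Lp ℂ 2 (@haarAddCircle T hT)),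
      (g : AddCircle T → ℂ) =ᵐ[haarAddCircle] (fun x => fourier j x * f x) →
      ‖W g‖ ^ 2 ≤ A * ‖g‖ ^ 2) (ε : ℝ) (hε : 0 < ε) :
    ∃ N₀ : ℕ, ∀ N ≥ N₀, ∀ a, win lam a N ≤ N * (A + ε) := by
  have hC0 : 0 ≤ C := (norm_nonneg _).trans (hbd 0)
  have hf0 : 0 < ‖f‖ := norm_pos_iff.2 hf
  set c := ‖f‖ ^ 2 with hc
  have hcp : 0 < c := by positivity
  set δ := c * ε / (2 * (C ^ 2 + 1)) with hδ
  have hδ0 : 0 < δ := by positivity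
  obtain ⟨F, hF⟩ : ∃ F : Finset ℤ, c - δ < ∑ m ∈ F, ‖fourierBasis.repr f m‖ ^ 2 :=
    ((parseval f).eventually (lt_mem_nhds (by linarith))).exists
  set s := ∑ m ∈ F, ‖fourierBasis.repr f m‖ ^ 2 with hs
  set R := ∑ m ∈ F, |(m : ℝ)| * C ^ 2 * ‖fourierBasis.repr f m‖ ^ 2 with hR
  obtain ⟨N₀, hN₀⟩ := exists_nat_ge (2 * R / (c * ε))
  refine ⟨N₀, fun N hN a => ?_⟩
  choose g hg1 hg2 using fun j : ℕ => exists_shift (a + (j : ℤ)) f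
  have h1 := shift_sum lam W hW a N f g hg2
  have h2 : ∑ m ∈ F, win lam (m + a) N * ‖fourierBasis.repr f m‖ ^ 2 ≤
      ∑ j ∈ Finset.range N, ‖W (g j)‖ ^ 2 :=
    sum_le_hasSum F (fun m _ => mul_nonneg (win_nonneg _ _ _) (by positivity)) h1
  have h3 : ∑ j ∈ Finset.range N, ‖W (g j)‖ ^ 2 ≤ N * (A * c) := by
    calc _ ≤ ∑ j ∈ Finset.range N, A * c := Finset.sum_le_sum fun j _ => by
          rw [hc, ← parseval_shift lam W hW _ f (g j) (hg2 j)]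
          exact hA _ _ (hg1 j)
      _ = _ := by simp
  have h4 : win lam a N * s - R ≤
      ∑ m ∈ F, win lam (m + a) N * ‖fourierBasis.repr f m‖ ^ 2 := by
    rw [hs, hR, Finset.mul_sum, ← Finset.sum_sub_distrib]
    refine Finset.sum_le_sum fun m _ => ?_
    rw [← sub_mul]
    have := (abs_le.1 (win_shift lam C hbd a m N)).1
    gcongr
    linarith
  have h5 := win_le lam C hbd a N
  have h6 : win lam a N * (c - s) ≤ N * C ^ 2 * δ := by
    have h0 := win_nonneg lam a N
    calc _ ≤ win lam a N * δ := by gcongr; linarith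
      _ ≤ _ := by gcongr
  have h7 : C ^ 2 * δ ≤ c * ε / 2 := by
    rw [hδ, mul_div_assoc', div_le_div_iff₀ (by positivity) (by norm_num)]
    have : 0 < c * ε := by positivity
    nlinarith
  have h8 : R ≤ N * (c * ε / 2) := by
    have : 2 * R / (c * ε) ≤ N := hN₀.trans (by exact_mod_cast hN)
    rw [div_le_iff₀ (by positivity)] at this
    linarith
  have h9 : (N : ℝ) * (C ^ 2 * δ) ≤ N * (c * ε / 2) := by gcongr
  refine le_of_mul_le_mul_right ?_ hcp
  nlinarith

end Op

/-- Existence of fine partitions. -/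
lemma exists_partition (L : ℕ) (η : ℝ) (hη : 0 < η) :
    ∃ χ : Partition (@haarAddCircle T hT), ∀ j, ∃ x₀ : AddCircle T, ∀ x ∈ χ.Y j, ∀ m < L,
      ‖fourier (m : ℤ) x₀ - fourier (m : ℤ) x‖ ≤ η := by
  classical
  let U : AddCircle T → Set (AddCircle T) := fun x₀ =>
    ⋂ m ∈ Finset.range L, {x | ‖fourier (m : ℤ) x₀ - fourier (m : ℤ) x‖ < η}
  have hUo : ∀ x₀, IsOpen (U x₀) := fun x₀ => by
    refine isOpen_biInter_finset fun m _ => ?_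
    exact isOpen_lt ((continuous_const.sub (fourier (m : ℤ)).continuous).norm) continuous_const
  have hUm : ∀ x₀, x₀ ∈ U x₀ := fun x₀ => by simp [U, hη]
  obtain ⟨t, ht⟩ := CompactSpace.elim_nhds_subcover U fun x => (hUo x).mem_nhds (hUm x)
  let e := t.equivFin.symm
  let V : Fin t.card → Set (AddCircle T) := fun j => U (e j)
  refine ⟨⟨t.card, fun j => V j \ ⋃ i < j, V i, ?_, ?_, ?_⟩, ?_⟩
  · intro j
    exact (hUo _).measurableSet.diff
      (MeasurableSet.iUnion fun i => MeasurableSet.iUnion fun _ => (hUo _).measurableSet)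
  · convert measure_empty (μ := @haarAddCircle T hT)
    rw [Set.sdiff_eq_empty]
    intro x _
    have hx : ∃ j, x ∈ V j := by
      have : x ∈ ⋃ y ∈ t, U y := by rw [ht]; trivial
      simp only [Set.mem_iUnion] at this
      obtain ⟨y, hy, hxy⟩ := this
      exact ⟨t.equivFin ⟨y, hy⟩, by simpa [V, e] using hxy⟩
    obtain ⟨j, hj, hmin⟩ := WellFounded.has_min (wellFounded_lt (α := Fin t.card)) {j | x ∈ V j} hx
    refine Set.mem_iUnion.2 ⟨j, hj, ?_⟩
    simp only [Set.mem_iUnion, not_exists]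
    intro i hij hi
    exact hmin i hi hij
  · intro j k hjk
    convert measure_empty (μ := @haarAddCircle T hT)
    ext x
    simp only [Set.mem_inter_iff, Set.mem_sdiff, Set.mem_iUnion, not_exists,
      Set.mem_empty_iff_false, iff_false]
    rintro ⟨⟨h1, h2⟩, h3, h4⟩
    rcases lt_or_gt_of_ne hjk with h | h
    · exact h4 j h h1
    · exact h2 k h h3
  · intro j
    refine ⟨e j, fun x hx m hm => ?_⟩
    have := hx.1
    simp only [V, U, Set.mem_iInter, Finset.mem_range] at this
    exact (this m hm).le

lemma partition_sum (χ : Partition (@haarAddCircle T hT)) :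
    ∑ j, ((@haarAddCircle T hT) (χ.Y j)).toReal = 1 := by
  have h1 : (@haarAddCircle T hT) (⋃ j, χ.Y j) = ∑ j, (@haarAddCircle T hT) (χ.Y j) := by
    rw [measure_iUnion₀, tsum_fintype]
    · intro j k hjk
      exact χ.disj j k hjk
    · exact fun j => (χ.meas j).nullMeasurableSet
  have h2 : (@haarAddCircle T hT) (⋃ j, χ.Y j) = 1 := by
    have := χ.cover
    rw [← Set.compl_eq_univ_sdiff] at this
    exact (prob_compl_eq_zero_iff (MeasurableSet.iUnion χ.meas)).1 this
  rw [← ENNReal.toReal_sum (fun j _ => measure_ne_top _ _), ← h1, h2]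
  simp

section Rho

variable (lam : ℤ → ℂ) (C : ℝ) (hbd : ∀ k, ‖lam k‖ ≤ C)

instance : NeBot (Filter.comap (Prod.snd : ℤ × ℕ → ℕ) Filter.atTop) :=
  Filter.NeBot.comap_of_surj inferInstance Prod.snd_surjective

lemma rho_eq : rho lam = Filter.limsup (fun p : ℤ × ℕ => (1 / (p.2 : ℝ)) * win lam p.1 p.2)
    (Filter.comap Prod.snd Filter.atTop) := by
  unfold rho
  simp only [win_eq]

include hbd

lemma rho_bdd : IsBoundedUnder (· ≤ ·) (Filter.comap (Prod.snd : ℤ × ℕ → ℕ) Filter.atTop)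
    (fun p : ℤ × ℕ => (1 / (p.2 : ℝ)) * win lam p.1 p.2) := by
  refine isBoundedUnder_of ⟨C ^ 2, fun p => ?_⟩
  have h := win_le lam C hbd p.1 p.2
  rcases Nat.eq_zero_or_pos p.2 with h0 | h0
  · simp only [h0]; simp; positivity
  · have : (0 : ℝ) < p.2 := by exact_mod_cast h0
    rw [one_div_mul_eq_div, div_le_iff₀ this]
    linarith

omit hbd in
lemma rho_cobdd : IsCoboundedUnder (· ≤ ·) (Filter.comap (Prod.snd : ℤ × ℕ → ℕ) Filter.atTop)
    (fun p : ℤ × ℕ => (1 / (p.2 : ℝ)) * win lam p.1 p.2) := by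
  refine IsBoundedUnder.isCoboundedUnder_le (isBoundedUnder_of ⟨0, fun p => ?_⟩)
  have := win_nonneg lam p.1 p.2
  positivity

lemma rho_nonneg : 0 ≤ rho lam := by
  rw [rho_eq]
  refine le_limsup_of_frequently_le (Eventually.frequently (Eventually.of_forall fun p => ?_))
    (rho_bdd lam C hbd)
  have := win_nonneg lam p.1 p.2
  positivity

lemma rho_upper (b : ℝ) (hb : rho lam < b) : ∃ L : ℕ, 0 < L ∧ ∀ a, win lam a L ≤ L * b := by
  rw [rho_eq] at hb
  have h := eventually_lt_of_limsup_lt hb (rho_bdd lam C hbd)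
  rw [eventually_comap] at h
  obtain ⟨L, hL, hL0⟩ := (h.and (eventually_gt_atTop 0)).exists
  refine ⟨L, hL0, fun a => ?_⟩
  have := hL (a, L) rfl
  have hp : (0 : ℝ) < L := by exact_mod_cast hL0
  simp only at this
  rw [one_div_mul_eq_div, div_lt_iff₀ hp] at this
  linarith

omit hbd in
lemma rho_le (b : ℝ) (N₀ : ℕ) (h : ∀ N ≥ N₀, ∀ a, win lam a N ≤ N * b) : rho lam ≤ b := by
  rw [rho_eq]
  refine limsup_le_of_le (rho_cobdd lam) ?_
  rw [eventually_comap]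
  filter_upwards [eventually_ge_atTop N₀, eventually_gt_atTop 0] with N hN hN0 p hp
  subst hp
  have hp : (0 : ℝ) < p.2 := by exact_mod_cast hN0
  rw [one_div_mul_eq_div, div_le_iff₀ hp]
  linarith [h p.2 hN p.1]

end Rho

section Final

variable (lam : ℤ → ℂ) (C : ℝ) (hbd : ∀ k, ‖lam k‖ ≤ C)
  (W : Lp ℂ 2 (@haarAddCircle T hT) →L[ℂ] Lp ℂ 2 (@haarAddCircle T hT))
  (hW : ∀ f, ∀ k : ℤ, fourierBasis.repr (W f) k = lam k * fourierBasis.repr f k)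
  (proj : Set (AddCircle T) →
    (Lp ℂ 2 (@haarAddCircle T hT) →L[ℂ] Lp ℂ 2 (@haarAddCircle T hT)))
  (hproj : IsIndicatorProj (@haarAddCircle T hT) proj)

include hbd hW hproj

lemma proj_lower (Y : Set (AddCircle T)) (hY : MeasurableSet Y)
    (hpos : (@haarAddCircle T hT) Y ≠ 0) : rho lam ≤ ‖W.comp (proj Y)‖ ^ 2 := by
  refine le_of_forall_pos_le_add fun ε hε => ?_
  have hp := hproj Y hY (fourierLp 2 0)
  have h0 := coeFn_fourierLp (T := T) 2 0
  set f := proj Y (fourierLp 2 0) with hfdef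
  have hf1 : (f : AddCircle T → ℂ) =ᵐ[haarAddCircle] Y.indicator 1 := by
    filter_upwards [hp, h0] with x h1 h2
    rw [h1]
    by_cases hx : x ∈ Y
    · rw [Set.indicator_of_mem hx, Set.indicator_of_mem hx, h2, fourier_zero, Pi.one_apply]
    · rw [Set.indicator_of_notMem hx, Set.indicator_of_notMem hx]
  have hfne : f ≠ 0 := by
    intro h
    apply hpos
    have hz := Lp.coeFn_zero ℂ 2 (@haarAddCircle T hT)
    rw [h] at hf1
    have : ∀ᵐ x ∂(@haarAddCircle T hT), x ∉ Y := by
      filter_upwards [hf1, hz] with x h1 h2 hx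
      rw [h2] at h1
      simp [hx] at h1
    rw [ae_iff] at this
    simpa only [not_not, Set.setOf_mem_eq] using this
  have hA : ∀ (j : ℤ) (g : Lp ℂ 2 (@haarAddCircle T hT)),
      (g : AddCircle T → ℂ) =ᵐ[haarAddCircle] (fun x => fourier j x * f x) →
      ‖W g‖ ^ 2 ≤ ‖W.comp (proj Y)‖ ^ 2 * ‖g‖ ^ 2 := by
    intro j g hg
    have hgp : proj Y g = g := by
      apply Lp.ext
      filter_upwards [hproj Y hY g, hg, hf1] with x h1 h2 h3
      rw [h1]
      by_cases hx : x ∈ Y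
      · simp [hx]
      · simp only [Set.indicator_of_notMem hx]
        rw [h2, h3]; simp [hx]
    have := (W.comp (proj Y)).le_opNorm g
    rw [ContinuousLinearMap.comp_apply, hgp] at this
    rw [← mul_pow]
    gcongr
  obtain ⟨N₀, hN₀⟩ := lower lam C hbd W hW (‖W.comp (proj Y)‖ ^ 2) f hfne hA ε hε
  exact rho_le lam _ N₀ hN₀

lemma M_lower (χ : Partition (@haarAddCircle T hT)) :
    rho lam ≤ M (@haarAddCircle T hT) proj W χ := by
  unfold M
  calc rho lam = ∑ j, ((@haarAddCircle T hT) (χ.Y j)).toReal * rho lam := by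
        rw [← Finset.sum_mul, partition_sum, one_mul]
    _ ≤ _ := by
        refine Finset.sum_le_sum fun j _ => ?_
        by_cases h : (@haarAddCircle T hT) (χ.Y j) = 0
        · simp [h]
        · have := proj_lower lam C hbd W hW proj hproj (χ.Y j) (χ.meas j) h
          gcongr

lemma M_upper (ε : ℝ) (hε : 0 < ε) :
    ∃ χ : Partition (@haarAddCircle T hT), M (@haarAddCircle T hT) proj W χ ≤ rho lam + ε := by
  obtain ⟨L, hL0, hL⟩ := rho_upper lam C hbd (rho lam + ε / 2) (by linarith)
  have hr := rho_nonneg lam C hbd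
  set η := min 1 (ε / (6 * (C ^ 2 + 1))) with hη
  have hη0 : 0 < η := by positivity
  have hη2 : 3 * C ^ 2 * η ≤ ε / 2 := by
    have h1 : η ≤ ε / (6 * (C ^ 2 + 1)) := min_le_right _ _
    rw [le_div_iff₀ (by positivity)] at h1
    nlinarith
  obtain ⟨χ, hχ⟩ := exists_partition (T := T) L η hη0
  refine ⟨χ, ?_⟩
  have key : ∀ j, ‖W.comp (proj (χ.Y j))‖ ^ 2 ≤ rho lam + ε := by
    intro j
    obtain ⟨x₀, hx₀⟩ := hχ j
    have : ‖W.comp (proj (χ.Y j))‖ ≤ √(rho lam + ε) := by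
      refine ContinuousLinearMap.opNorm_le_bound _ (Real.sqrt_nonneg _) fun f => ?_
      rw [ContinuousLinearMap.comp_apply]
      have hpf : ‖proj (χ.Y j) f‖ ≤ ‖f‖ := by
        apply Lp.norm_le_norm_of_ae_le
        filter_upwards [hproj _ (χ.meas j) f] with x h
        rw [h]; exact norm_indicator_le_norm_self _ _
      have h := upper lam C hbd W hW L hL0 (rho lam + ε / 2) η hη0.le (min_le_left _ _) hL
        (proj (χ.Y j) f) (fun m => fourier (m : ℤ) x₀) (fun m => fourier_norm_apply _ _) (by
          intro m hm
          filter_upwards [hproj _ (χ.meas j) f] with x h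
          rw [norm_mul, h]
          by_cases hx : x ∈ χ.Y j
          · have := hx₀ x hx m hm
            gcongr
          · simp [hx])
      refine (sq_le_sq₀ (norm_nonneg _) (by positivity)).1 ?_
      rw [mul_pow, Real.sq_sqrt (by positivity)]
      refine h.trans (mul_le_mul (by linarith) ?_ (by positivity) (by positivity))
      gcongr
    calc _ ≤ √(rho lam + ε) ^ 2 := by gcongr
      _ = _ := Real.sq_sqrt (by positivity)
  unfold M
  calc _ ≤ ∑ j, ((@haarAddCircle T hT) (χ.Y j)).toReal * (rho lam + ε) := by
        refine Finset.sum_le_sum fun j _ => ?_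
        have := key j
        gcongr
    _ = rho lam + ε := by rw [← Finset.sum_mul, partition_sum, one_mul]

lemma munorm_eq : munorm (@haarAddCircle T hT) proj W ^ 2 = rho lam := by
  have hr := rho_nonneg lam C hbd
  obtain ⟨χ₀, _⟩ := M_upper lam C hbd W hW proj hproj 1 one_pos
  haveI : Nonempty (Partition (@haarAddCircle T hT)) := ⟨χ₀⟩
  have hb : BddBelow (Set.range fun χ : Partition (@haarAddCircle T hT) =>
      √(M (@haarAddCircle T hT) proj W χ)) := ⟨0, by rintro _ ⟨χ, rfl⟩; exact Real.sqrt_nonneg _⟩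
  have hl : √(rho lam) ≤ munorm (@haarAddCircle T hT) proj W :=
    le_ciInf fun χ => Real.sqrt_le_sqrt (M_lower lam C hbd W hW proj hproj χ)
  have h0 : 0 ≤ munorm (@haarAddCircle T hT) proj W := (Real.sqrt_nonneg _).trans hl
  apply le_antisymm
  · refine le_of_forall_pos_le_add fun ε hε => ?_
    obtain ⟨χ, hχ⟩ := M_upper lam C hbd W hW proj hproj ε hε
    have : munorm (@haarAddCircle T hT) proj W ≤ √(rho lam + ε) :=
      (ciInf_le hb χ).trans (Real.sqrt_le_sqrt hχ)
    calc _ ≤ √(rho lam + ε) ^ 2 := by gcongr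
      _ = _ := Real.sq_sqrt (by positivity)
  · calc rho lam = √(rho lam) ^ 2 := (Real.sq_sqrt hr).symm
      _ ≤ _ := by gcongr

end Final

end Helpers

theorem conv_norm_and_munorm
    (lam : ℤ → ℂ) (C : ℝ) (hbd : ∀ k, ‖lam k‖ ≤ C)
    (proj : Set (AddCircle (2 * π)) →
      (Lp ℂ 2 (@AddCircle.haarAddCircle (2 * π) _) →L[ℂ]
        Lp ℂ 2 (@AddCircle.haarAddCircle (2 * π) _)))
    (hproj : IsIndicatorProj (@AddCircle.haarAddCircle (2 * π) _) proj)
    (W : Lp ℂ 2 (@AddCircle.haarAddCircle (2 * π) _) →L[ℂ]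
      Lp ℂ 2 (@AddCircle.haarAddCircle (2 * π) _))
    (hW : ∀ f, ∀ k : ℤ,
      fourierBasis.repr (W f) k = lam k * fourierBasis.repr f k) :
    ‖W‖ = (⨆ k : ℤ, ‖lam k‖) ∧
    munorm (@AddCircle.haarAddCircle (2 * π) _) proj W ^ 2 = rho lam := by
  exact ⟨normW_eq lam C hbd W hW, munorm_eq lam C hbd W hW proj hproj⟩


end MuNorm
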